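/- arXiv:2504.03399 — 7 statements merged into one kernel-verified Lean document; each statement's English description precedes it below -/
import Mathlib

section
/- Let N be a nonempty finite set of players; for each ν ∈ N let X_ν be a nonempty compact convex subset of a real Banach space E_ν, and X = ∏_{ν∈N} X_ν. Let g = (C_ν, P_ν)_{ν∈N} be an abstract economy profile satisfying, for each ν ∈ N: (A1) C_ν and P_ν are upper semicontinuous with closed convex values; (A2) C_ν has nonempty values; (A3) the set I_ν(g) := {x ∈ X : C_ν(x) ∩ P_ν(x) ≠ ∅} is open in X; (A4) for each x ∈ X, x_ν ∈ C_ν(x) implies x_ν ∉ P_ν(x). Then g has a Nash equilibrium: there exists x̄ ∈ X such that for every ν ∈ N, x̄_ν ∈ C_ν(x̄) and C_ν(x̄) ∩ P_ν(x̄) = ∅. -/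
open Metric Set Filter Topology
open scoped ENNReal

/-- Upper semicontinuity of a set-valued map. -/
def UpperSemicontinuousSV {D Y : Type*} [TopologicalSpace D] [TopologicalSpace Y]
    (F : D → Set Y) : Prop :=
  ∀ x : D, ∀ U : Set Y, IsOpen U → F x ⊆ U → ∀ᶠ x' in nhds x, F x' ⊆ U

section Brouwer

open MeasureTheory Module

/-- The determinant of `1 + t • A` at `t = 1` is a fixed linear combination, with coefficients of
sum one, of its values at sufficiently many distinct nodes `v i`. -/
lemma det_one_add_eq_sum_lagrange {E : Type*} [NormedAddCommGroup E] [NormedSpace ℝ E]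
    [FiniteDimensional ℝ E] {s : Finset ℕ} (hs : finrank ℝ E < s.card) {v : ℕ → ℝ}
    (hv : Set.InjOn v s) (A : E →L[ℝ] E) :
    (1 + A).det = ∑ i ∈ s, (Lagrange.basis s v i).eval 1 * (1 + v i • A).det := by
  classical
  let b := finBasis ℝ E
  let M := LinearMap.toMatrix b b (A : E →ₗ[ℝ] E)
  let p : Polynomial ℝ := Matrix.det
    ((Polynomial.X : Polynomial ℝ) • M.map Polynomial.C +
      (1 : Matrix (Fin (finrank ℝ E)) (Fin (finrank ℝ E)) ℝ).map Polynomial.C)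
  have hp : ∀ t : ℝ, p.eval t = (1 + t • A).det := by
    intro t
    have h1 : ((1 + t • A : E →L[ℝ] E)).det = (1 + t • M).det := by
      rw [ContinuousLinearMap.det, ← LinearMap.det_toMatrix b]
      congr 1
      simp [M, LinearMap.toMatrix_one]
    rw [h1, ← Polynomial.coe_evalRingHom, RingHom.map_det]
    congr 1
    ext i j
    simp only [RingHom.mapMatrix_apply, Matrix.map_apply, Matrix.add_apply, Matrix.smul_apply,
      smul_eq_mul, map_add, Polynomial.coe_evalRingHom, Polynomial.eval_mul,
      Polynomial.eval_X, Polynomial.eval_C]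
    ring
  have hdeg : p.degree < s.card := by
    refine lt_of_le_of_lt Polynomial.degree_le_natDegree ?_
    have := Polynomial.natDegree_det_X_add_C_le M 1
    rw [Fintype.card_fin] at this
    exact_mod_cast this.trans_lt hs
  have h := Lagrange.eq_interpolate hv hdeg
  have h1 := hp 1
  rw [one_smul] at h1
  rw [← h1, h, Lagrange.interpolate_apply, Polynomial.eval_finsetSum]
  refine Finset.sum_congr rfl fun i _ => ?_
  rw [Polynomial.eval_mul, Polynomial.eval_C, hp]
  ring

lemma det_one_add_smul_pos {E : Type*} [NormedAddCommGroup E] [NormedSpace ℝ E]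
    [FiniteDimensional ℝ E] (A : E →L[ℝ] E) {t : ℝ} (ht : 0 ≤ t) (hA : t * ‖A‖ < 1) :
    0 < (1 + t • A).det := by
  have hne : ∀ r ∈ Icc 0 t, (1 + r • A).det ≠ 0 := by
    intro r hr
    have hr' : ‖r • A‖ < 1 := by
      rw [norm_smul, Real.norm_of_nonneg hr.1]
      exact (mul_le_mul_of_nonneg_right hr.2 (norm_nonneg _)).trans_lt hA
    have hu : IsUnit (1 + r • A) := by
      have := isUnit_one_sub_of_norm_lt_one (x := -(r • A)) (by rwa [norm_neg])
      simpa using this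
    have : IsUnit ((1 + r • A : E →L[ℝ] E) : E →ₗ[ℝ] E) :=
      hu.map (ContinuousLinearMap.toLinearMapRingHom (R₁ := ℝ) (M₁ := E))
    exact ((LinearMap.isUnit_iff_isUnit_det _).1 this).ne_zero
  have hcont : ContinuousOn (fun r : ℝ => (1 + r • A).det) (Icc 0 t) :=
    (ContinuousLinearMap.continuous_det.comp (by fun_prop)).continuousOn
  by_contra hneg
  push Not at hneg
  have h0 : (0 : ℝ) ∈ Icc ((1 + t • A).det) ((1 + (0 : ℝ) • A).det) := by
    refine ⟨hneg, ?_⟩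
    rw [zero_smul, add_zero, ContinuousLinearMap.det]
    simp
  obtain ⟨r, hr, hr0⟩ := intermediate_value_Icc' ht hcont h0
  exact hne r hr hr0

/-- A map which is Lipschitz on a closed ball and vanishes on its boundary sphere remains Lipschitz
when extended by zero. -/
lemma LipschitzOnWith.lipschitzWith_indicator_closedBall {E F : Type*} [NormedAddCommGroup E]
    [NormedSpace ℝ E] [NormedAddCommGroup F] {K : NNReal} {G : E → F} {r : ℝ}
    (hG : LipschitzOnWith K G (closedBall 0 r)) (h0 : ∀ x, ‖x‖ = r → G x = 0) :
    LipschitzWith K ((closedBall (0 : E) r).indicator G) := by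
  have key : ∀ x y : E, ‖x‖ ≤ r → r < ‖y‖ → dist (G x) 0 ≤ K * dist x y := by
    intro x y hx hy
    have hcont : ContinuousOn (fun s : ℝ => ‖AffineMap.lineMap x y s‖) (Icc (0:ℝ) 1) := by
      have : Continuous (fun s : ℝ => AffineMap.lineMap x y s) := AffineMap.lineMap_continuous
      exact this.norm.continuousOn
    obtain ⟨s, hs, hsr⟩ := intermediate_value_Icc zero_le_one hcont
      (show r ∈ Icc _ _ by simpa using ⟨hx, hy.le⟩)
    have hsr' : ‖(AffineMap.lineMap x y s : E)‖ = r := hsr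
    rw [← h0 _ hsr']
    refine (hG.dist_le_mul x (by simpa using hx) _ (by simpa using hsr'.le)).trans ?_
    gcongr
    rw [dist_left_lineMap, Real.norm_of_nonneg hs.1]
    exact mul_le_of_le_one_left dist_nonneg hs.2
  refine LipschitzWith.of_dist_le_mul fun x y => ?_
  by_cases hx : x ∈ closedBall (0 : E) r <;> by_cases hy : y ∈ closedBall (0 : E) r
  · rw [indicator_of_mem hx, indicator_of_mem hy]
    exact hG.dist_le_mul x hx y hy
  · rw [indicator_of_mem hx, indicator_of_notMem hy]
    exact key x y (by simpa using hx) (by simpa using hy)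
  · rw [indicator_of_notMem hx, indicator_of_mem hy, dist_comm, dist_comm x y]
    exact key y x (by simpa using hy) (by simpa using hx)
  · rw [indicator_of_notMem hx, indicator_of_notMem hy, dist_self]
    positivity

/-- A small perturbation of the identity by a Lipschitz map supported in the unit ball restricts to
a bijection of the open unit ball. -/
lemma bijOn_ball_id_add_smul {E : Type*} [NormedAddCommGroup E] [NormedSpace ℝ E]
    [CompleteSpace E] {K : NNReal} {G : E → E} (hG : LipschitzWith K G)
    (h0 : ∀ x, 1 ≤ ‖x‖ → G x = 0) {t : ℝ} (ht : 0 ≤ t) (htK : t * K < 1) :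
    BijOn (fun x => x + t • G x) (ball 0 1) (ball 0 1) := by
  lift t to NNReal using ht
  have happ : ApproximatesLinearOn (fun x => x + (t : ℝ) • G x)
      (ContinuousLinearEquiv.refl ℝ E : E →L[ℝ] E) univ (t * K) := by
    apply LipschitzOnWith.approximatesLinearOn
    rw [lipschitzOnWith_univ]
    have : LipschitzWith (‖(t : ℝ)‖₊ * K) (fun x => (t : ℝ) • G x) :=
      (lipschitzWith_smul (t : ℝ)).comp hG
    convert this using 1
    · simp
    · ext x; simp
  have hc : Subsingleton E ∨ t * K <
      ‖((ContinuousLinearEquiv.refl ℝ E).symm : E →L[ℝ] E)‖₊⁻¹ := by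
    rcases subsingleton_or_nontrivial E with h | h
    · exact Or.inl h
    · right
      have : ‖((ContinuousLinearEquiv.refl ℝ E).symm : E →L[ℝ] E)‖₊ = 1 := by
        exact NNReal.eq ContinuousLinearMap.norm_id
      rw [this, inv_one]
      exact_mod_cast htK
  have hinj := injOn_univ.1 (happ.injOn hc)
  have hsurj := happ.surjective hc
  have hout : ∀ x : E, x ∉ ball (0 : E) 1 → x + (t : ℝ) • G x = x := by
    intro x hx
    rw [h0 x (by simpa using hx), smul_zero, add_zero]
  refine ⟨fun x hx => ?_, hinj.injOn, fun y hy => ?_⟩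
  · by_contra hx'
    have hfix : x + (t : ℝ) • G x = x := hinj (hout _ hx')
    exact hx' (show x + (t : ℝ) • G x ∈ ball 0 1 by rwa [hfix])
  · obtain ⟨x, hx⟩ := hsurj y
    refine ⟨x, ?_, hx⟩
    by_contra hx'
    exact hx' (by rwa [← hout x hx', show x + (t : ℝ) • G x = y from hx])

/-- There is no `C¹` retraction of the closed unit ball onto the unit sphere. -/
theorem no_contDiffOn_retraction {E : Type*} [NormedAddCommGroup E] [InnerProductSpace ℝ E]
    [FiniteDimensional ℝ E] {h : E → E} (hd : ContDiffOn ℝ 1 h (closedBall 0 1))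
    (hnorm : ∀ x, ‖x‖ ≤ 1 → ‖h x‖ = 1) (hid : ∀ x, ‖x‖ = 1 → h x = x) : False := by
  let : MeasurableSpace E := borel E
  have : BorelSpace E := ⟨rfl⟩
  let μ : Measure E := volume
  obtain ⟨K, hK⟩ := (hd.sub contDiffOn_id).exists_lipschitzOnWith one_ne_zero
    (convex_closedBall 0 1) (isCompact_closedBall 0 1)
  set G := (closedBall (0 : E) 1).indicator (h - id) with hGdef
  have hG : LipschitzWith K G := hK.lipschitzWith_indicator_closedBall
    fun x hx => by simp [hid x hx]
  have hG0 : ∀ x, 1 ≤ ‖x‖ → G x = 0 := by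
    intro x hx
    by_cases hx' : x ∈ closedBall (0 : E) 1
    · rw [hGdef, indicator_of_mem hx']
      simp [hid x (le_antisymm (by simpa using hx') hx)]
    · exact indicator_of_notMem hx' _
  have hGh : ∀ x ∈ ball (0 : E) 1, G =ᶠ[𝓝 x] h - id := by
    intro x hx
    filter_upwards [isOpen_ball.mem_nhds hx] with y hy
    exact indicator_of_mem (ball_subset_closedBall hy) _
  have hdiff : ∀ x ∈ ball (0 : E) 1, DifferentiableAt ℝ h x := fun x hx =>
    (hd.contDiffAt (mem_of_superset (isOpen_ball.mem_nhds hx)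
      ball_subset_closedBall)).differentiableAt one_ne_zero
  have hGdiff : ∀ x ∈ ball (0 : E) 1, DifferentiableAt ℝ G x := fun x hx =>
    ((hdiff x hx).sub differentiableAt_id).congr_of_eventuallyEq (hGh x hx)
  have hdet0 : ∀ x ∈ ball (0 : E) 1, (1 + fderiv ℝ G x).det = 0 := by
    intro x hx
    have hfd : 1 + fderiv ℝ G x = fderiv ℝ h x := by
      rw [(hGh x hx).fderiv_eq, fderiv_sub (hdiff x hx) differentiableAt_id, fderiv_id]
      exact add_sub_cancel _ _
    rw [hfd]
    by_contra hdet
    have hunit : IsUnit ((fderiv ℝ h x : E →ₗ[ℝ] E)) :=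
      (LinearMap.isUnit_iff_isUnit_det _).2 (isUnit_iff_ne_zero.2 hdet)
    obtain ⟨v, hv⟩ := ((Module.End.isUnit_iff _).1 hunit).2 (h x)
    have hv' : fderiv ℝ h x v = h x := hv
    have hc : (fun y => ‖h y‖ ^ 2) =ᶠ[𝓝 x] fun _ => (1 : ℝ) := by
      filter_upwards [isOpen_ball.mem_nhds hx] with y hy
      rw [hnorm y (by simpa using (ball_subset_closedBall hy)), one_pow]
    have h1 := (hdiff x hx).hasFDerivAt.norm_sq
    have h2 := h1.unique ((hasFDerivAt_const (1 : ℝ) x).congr_of_eventuallyEq hc)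
    have h3 := congrArg (fun L : E →L[ℝ] ℝ => L v) h2
    simp [hv'] at h3
    have := hnorm x (by simpa using (ball_subset_closedBall hx))
    rw [h3] at this
    simp at this
  have hnormG : ∀ x, ‖fderiv ℝ G x‖ ≤ K := fun x => norm_fderiv_le_of_lipschitz ℝ hG
  let s := Finset.range (finrank ℝ E + 1)
  let v : ℕ → ℝ := fun i => ((i + 1 : ℝ) * (K + 1))⁻¹
  have hv : Set.InjOn v s := by
    intro i _ j _ hij
    have hK1 : (K + 1 : ℝ) ≠ 0 := by positivity
    have := mul_right_cancel₀ hK1 (inv_injective hij)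
    exact_mod_cast add_right_cancel this
  have hv0 : ∀ i, 0 ≤ v i := fun i => by positivity
  have hv1 : ∀ i, v i * K < 1 := by
    intro i
    have : (K : ℝ) < (i + 1 : ℝ) * (K + 1) := by
      have hi : (0 : ℝ) ≤ i := Nat.cast_nonneg i
      nlinarith [K.2, hi, mul_nonneg hi K.2]
    rw [inv_mul_lt_one₀ (by positivity)]
    exact this
  have hpos : ∀ i x, 0 < (1 + v i • fderiv ℝ G x).det := fun i x =>
    det_one_add_smul_pos _ (hv0 i)
      ((mul_le_mul_of_nonneg_left (hnormG x) (hv0 i)).trans_lt (hv1 i))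
  have hder : ∀ i, ∀ x ∈ ball (0 : E) 1,
      HasFDerivWithinAt (fun x => x + v i • G x) (1 + v i • fderiv ℝ G x) (ball 0 1) x := by
    intro i x hx
    exact ((hasFDerivAt_id x).add ((hGdiff x hx).hasFDerivAt.const_smul (v i))).hasFDerivWithinAt
  have hbij := fun i => bijOn_ball_id_add_smul hG hG0 (hv0 i) (hv1 i)
  have hfin : IntegrableOn (fun _ : E => (1 : ℝ)) (ball 0 1) μ :=
    integrableOn_const measure_ball_lt_top.ne
  have hint : ∀ i, IntegrableOn (fun x => (1 + v i • fderiv ℝ G x).det) (ball 0 1) μ := by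
    intro i
    have := (integrableOn_image_iff_integrableOn_abs_det_fderiv_smul μ measurableSet_ball
      (hder i) (hbij i).injOn (fun _ => (1 : ℝ))).1 (by rwa [(hbij i).image_eq])
    simpa [abs_of_pos (hpos i _)] using this
  have hval : ∀ i, ∫ x in ball (0 : E) 1, (1 + v i • fderiv ℝ G x).det ∂μ = μ.real (ball 0 1) := by
    intro i
    have := integral_image_eq_integral_abs_det_fderiv_smul μ measurableSet_ball
      (hder i) (hbij i).injOn (fun _ => (1 : ℝ))
    rw [(hbij i).image_eq] at this
    simpa [abs_of_pos (hpos i _)] using this.symm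
  have hsum : ∑ i ∈ s, (Lagrange.basis s v i).eval 1 = 1 := by
    rw [← Polynomial.eval_finsetSum, Lagrange.sum_basis hv (by simp [s]), Polynomial.eval_one]
  have hcard : finrank ℝ E < s.card := by simp [s]
  have h0 : ∫ x in ball (0 : E) 1,
      ∑ i ∈ s, (Lagrange.basis s v i).eval 1 * (1 + v i • fderiv ℝ G x).det ∂μ = 0 :=
    setIntegral_eq_zero_of_forall_eq_zero fun x hx => by
      rw [← det_one_add_eq_sum_lagrange hcard hv, hdet0 x hx]
  rw [integral_finsetSum _ fun i _ => (hint i).const_mul _] at h0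
  simp_rw [integral_const_mul, hval] at h0
  rw [← Finset.sum_mul, hsum, one_mul] at h0
  exact (ENNReal.toReal_pos (measure_ball_pos μ 0 one_pos).ne' measure_ball_lt_top.ne).ne' h0

open scoped RealInnerProductSpace in
/-- **Brouwer's fixed point theorem** for `C¹` maps into the open unit ball. -/
lemma exists_fixedPoint_of_contDiff {E : Type*} [NormedAddCommGroup E] [InnerProductSpace ℝ E]
    [FiniteDimensional ℝ E] {g : E → E} (hg : ContDiff ℝ 1 g) (hg1 : ∀ x, ‖g x‖ < 1) :
    ∃ x, ‖x‖ ≤ 1 ∧ g x = x := by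
  by_contra! hne
  set d : E → E := fun x => x - g x with hd
  have hdC : ContDiff ℝ 1 d := contDiff_id.sub hg
  have hd0 : ∀ x, ‖x‖ ≤ 1 → 0 < ‖d x‖ := fun x hx =>
    norm_pos_iff.2 (sub_ne_zero.2 (hne x hx).symm)
  have hb : ∀ x, ‖x‖ = 1 → 0 < ⟪x, d x⟫ := by
    intro x hx
    have h1 : ⟪x, d x⟫ = 1 - ⟪x, g x⟫ := by
      rw [hd, inner_sub_right, real_inner_self_eq_norm_sq, hx, one_pow]
    have h2 := real_inner_le_norm x (g x)
    rw [hx, one_mul] at h2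
    linarith [hg1 x]
  set D : E → ℝ := fun x => ⟪x, d x⟫ ^ 2 + ‖d x‖ ^ 2 * (1 - ‖x‖ ^ 2) with hD
  have hDC : ContDiff ℝ 1 D :=
    ((contDiff_id.inner ℝ hdC).pow 2).add
      ((hdC.norm_sq ℝ).mul (contDiff_const.sub (contDiff_id.norm_sq ℝ)))
  have hDpos : ∀ x, ‖x‖ ≤ 1 → 0 < D x := by
    intro x hx
    rcases hx.eq_or_lt with h | h
    · have := hb x h
      simp only [hD, h]
      positivity
    · have h1 : 0 < 1 - ‖x‖ ^ 2 := by nlinarith [norm_nonneg x]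
      have h2 := hd0 x hx
      simp only [hD]
      positivity
  set l : E → ℝ := fun x => (-⟪x, d x⟫ + √(D x)) / ‖d x‖ ^ 2 with hl
  refine no_contDiffOn_retraction (h := fun x => x + l x • d x) ?_ ?_ ?_
  · intro x hx
    have hx1 : ‖x‖ ≤ 1 := by simpa using hx
    have hlC : ContDiffAt ℝ 1 l x :=
      (((contDiff_id.inner ℝ hdC).neg.contDiffAt).add
        (hDC.contDiffAt.sqrt (hDpos x hx1).ne')).div (hdC.norm_sq ℝ).contDiffAt
        (pow_pos (hd0 x hx1) 2).ne'
    exact (contDiffAt_id.add (hlC.smul hdC.contDiffAt)).contDiffWithinAt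
  · intro x hx
    have ha : ‖d x‖ ^ 2 ≠ 0 := (pow_pos (hd0 x hx) 2).ne'
    have hla : l x * ‖d x‖ ^ 2 = -⟪x, d x⟫ + √(D x) := div_mul_cancel₀ _ ha
    have hs := Real.sq_sqrt (hDpos x hx).le
    have hDx : D x = ⟪x, d x⟫ ^ 2 + ‖d x‖ ^ 2 * (1 - ‖x‖ ^ 2) := rfl
    have h1 : ‖x + l x • d x‖ ^ 2 = 1 := by
      rw [norm_add_sq_real, inner_smul_right, norm_smul, mul_pow, Real.norm_eq_abs, sq_abs]
      apply mul_left_cancel₀ ha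
      have : √(D x) = l x * ‖d x‖ ^ 2 + ⟪x, d x⟫ := by linarith
      rw [this, hDx] at hs
      linear_combination hs
    exact (pow_eq_one_iff_of_nonneg (norm_nonneg _) two_ne_zero).1 h1
  · intro x hx
    have hDx : D x = ⟪x, d x⟫ ^ 2 := by simp [hD, hx]
    have : l x = 0 := by
      simp only [hl]
      rw [hDx, Real.sqrt_sq (hb x hx).le, neg_add_cancel, zero_div]
    simp [this]

/-- **Brouwer's fixed point theorem** for continuous maps into the closed unit ball. -/
theorem exists_fixedPoint_of_continuous {E : Type*} [NormedAddCommGroup E]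
    [InnerProductSpace ℝ E] [FiniteDimensional ℝ E] {f : E → E} (hf : Continuous f)
    (hf1 : ∀ x, ‖f x‖ ≤ 1) : ∃ x, f x = x := by
  by_contra! hne
  obtain ⟨x₀, -, hx₀⟩ := (isCompact_closedBall (0 : E) 1).exists_isMinOn
    ⟨0, by simp⟩ (f := fun x => ‖f x - x‖) (by fun_prop)
  set ε := ‖f x₀ - x₀‖ / 2 with hε
  have hε0 : 0 < ε := half_pos (norm_pos_iff.2 (sub_ne_zero.2 (hne x₀)))
  obtain ⟨g, hg, hgf, -⟩ := hf.exists_contDiff_approx 1 (continuous_const (y := ε))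
    fun _ => hε0
  have hg1 : ∀ x, ‖g x‖ < 1 + ε := by
    intro x
    have h1 := norm_add_le (f x) (g x - f x)
    rw [add_sub_cancel, ← dist_eq_norm] at h1
    linarith [hgf x, hf1 x]
  obtain ⟨x, hx, hfix⟩ := exists_fixedPoint_of_contDiff (g := fun x => (1 + ε)⁻¹ • g x)
    (hg.const_smul _) fun x => by
      rw [norm_smul, norm_inv, Real.norm_of_nonneg (by positivity), inv_mul_lt_one₀ (by positivity)]
      exact hg1 x
  have hgx : g x = (1 + ε) • x := by
    rw [← hfix, smul_inv_smul₀ (by positivity)]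
    simp only [hfix]
  have h2 : ‖f x₀ - x₀‖ ≤ ‖f x - x‖ := hx₀ (by simpa using hx)
  have h3 : ‖f x - x‖ ≤ ‖f x - g x‖ + ‖g x - x‖ := norm_sub_le_norm_sub_add_norm_sub _ _ _
  have h4 : g x - x = ε • x := by rw [hgx]; module
  rw [h4, norm_smul, Real.norm_of_nonneg hε0.le, norm_sub_rev (f x) (g x),
    ← dist_eq_norm (g x)] at h3
  have h5 := hgf x
  have : ε * ‖x‖ ≤ ε := mul_le_of_le_one_right hε0.le hx
  linarith

/-- **Brouwer's fixed point theorem** on the standard simplex. -/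
theorem exists_fixedPoint_stdSimplex {ι : Type*} [Fintype ι] [Nonempty ι]
    {f : (ι → ℝ) → (ι → ℝ)} (hf : ContinuousOn f (stdSimplex ℝ ι))
    (hmaps : MapsTo f (stdSimplex ℝ ι) (stdSimplex ℝ ι)) : ∃ t ∈ stdSimplex ℝ ι, f t = t := by
  let S : (ι → ℝ) → ℝ := fun x => ∑ i, max (x i) 0
  let r : (ι → ℝ) → (ι → ℝ) := fun x i =>
    (max (x i) 0 + max (1 - S x) 0 / Fintype.card ι) / max 1 (S x)
  have hSc : Continuous S := by fun_prop
  have hpos : ∀ x, 0 < max 1 (S x) := fun x => lt_max_of_lt_left one_pos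
  have hrc : Continuous r := by
    refine continuous_pi fun i => Continuous.div ?_ (by fun_prop) fun x => (hpos x).ne'
    fun_prop
  have hr : ∀ x, r x ∈ stdSimplex ℝ ι := by
    intro x
    refine ⟨fun i => by have := hpos x; positivity, ?_⟩
    simp only [r]
    rw [← Finset.sum_div, Finset.sum_add_distrib, Finset.sum_const, Finset.card_univ,
      nsmul_eq_mul, mul_div_cancel₀ _ (by simp), div_eq_one_iff_eq (hpos x).ne']
    change S x + _ = _
    rcases le_total 1 (S x) with h | h
    · rw [max_eq_right h, max_eq_right (by linarith), add_zero]
    · rw [max_eq_left h, max_eq_left (by linarith), add_sub_cancel]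
  have hrid : ∀ x ∈ stdSimplex ℝ ι, r x = x := by
    intro x hx
    have hm : ∀ i, max (x i) 0 = x i := fun i => max_eq_left (hx.1 i)
    have hS : S x = 1 := by simp only [S, hm, hx.2]
    ext i
    simp [r, hS, hm]
  have hcont : Continuous fun x => f (r x) := hf.comp_continuous hrc hr
  let e := EuclideanSpace.equiv ι ℝ
  obtain ⟨x, hx⟩ := exists_fixedPoint_of_continuous (E := EuclideanSpace ℝ ι)
    (f := fun x => e.symm (f (r (e x)))) (e.symm.continuous.comp (hcont.comp e.continuous))
    (by
      intro x
      have h := hmaps (hr (e x))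
      rw [EuclideanSpace.norm_eq]
      refine Real.sqrt_le_one.2 ?_
      rw [← h.2]
      refine Finset.sum_le_sum fun i _ => ?_
      change ‖f (r (e x)) i‖ ^ 2 ≤ f (r (e x)) i
      have h0 := h.1 i
      have h1 := (mem_Icc_of_mem_stdSimplex h i).2
      rw [Real.norm_of_nonneg h0]
      nlinarith)
  have hx' : f (r (e x)) = e x := by
    rw [← e.apply_symm_apply (f (r (e x)))]
    exact congrArg e hx
  have hmem : e x ∈ stdSimplex ℝ ι := hx' ▸ hmaps (hr (e x))
  exact ⟨e x, hmem, by rwa [hrid _ hmem] at hx'⟩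

end Brouwer

/-- Approximate fixed points of set-valued self-maps of a compact convex set. -/
lemma exists_mem_convexHull_biUnion_ball {E : Type*} [NormedAddCommGroup E] [NormedSpace ℝ E]
    {K : Set E} (hne : K.Nonempty) (hcp : IsCompact K) (hcv : Convex ℝ K) {F : K → Set E}
    (hFK : ∀ x, F x ⊆ K) (hFne : ∀ x, (F x).Nonempty) {ε : ℝ} (hε : 0 < ε) :
    ∃ x : K, (x : E) ∈ convexHull ℝ (⋃ x' ∈ ball x ε, F x') := by
  have : CompactSpace K := isCompact_iff_compactSpace.1 hcp
  have : Nonempty K := hne.to_subtype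
  choose y hy using hFne
  obtain ⟨s, -, hsfin, hs⟩ := finite_cover_balls_of_compact (isCompact_univ (X := K)) hε
  have : Fintype s := hsfin.fintype
  have hcov : ∀ x : K, ∃ i : s, dist x i.1 < ε := by
    intro x
    obtain ⟨i, his, hi⟩ := mem_iUnion₂.1 (hs (mem_univ x))
    exact ⟨⟨i, his⟩, hi⟩
  have : Nonempty s := ⟨(hcov (Classical.arbitrary K)).choose⟩
  let φ : s → E → ℝ := fun i x => max (ε - dist x i.1) 0
  have hφ0 : ∀ i x, 0 ≤ φ i x := fun i x => le_max_right _ _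
  let S : E → ℝ := fun x => ∑ i, φ i x
  have hS : ∀ x ∈ K, 0 < S x := by
    intro x hx
    obtain ⟨i, hi⟩ := hcov ⟨x, hx⟩
    refine Finset.sum_pos' (fun i _ => hφ0 i x) ⟨i, Finset.mem_univ _, ?_⟩
    exact lt_max_of_lt_left (sub_pos.2 hi)
  let p : (s → ℝ) → E := fun t => ∑ i, t i • y i.1
  have hp : ∀ t ∈ stdSimplex ℝ s, p t ∈ K := fun t ht =>
    hcv.sum_mem (fun i _ => ht.1 i) ht.2 fun i _ => hFK _ (hy _)
  obtain ⟨t, ht, hfix⟩ := exists_fixedPoint_stdSimplex (f := fun t i => φ i (p t) / S (p t))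
    (continuousOn_pi.2 fun i => ContinuousOn.div (by fun_prop) (by fun_prop)
      fun t ht => (hS _ (hp t ht)).ne')
    (fun t ht => ⟨fun i => div_nonneg (hφ0 _ _) (hS _ (hp t ht)).le, by
      rw [← Finset.sum_div]
      exact div_self (hS _ (hp t ht)).ne'⟩)
  refine ⟨⟨p t, hp t ht⟩, ?_⟩
  refine mem_of_eq_of_mem (finsum_eq_sum_of_fintype fun i => t i • y i.1).symm ?_
  refine (convex_convexHull ℝ _).finsum_mem ht.1 (by rw [finsum_eq_sum_of_fintype, ht.2]) ?_
  intro i hi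
  refine subset_convexHull ℝ _ (mem_iUnion₂.2 ⟨i.1, ?_, hy _⟩)
  rw [mem_ball, dist_comm]
  by_contra hlt
  refine hi ?_
  rw [← hfix]
  have : φ i (p t) = 0 := max_eq_right (sub_nonpos.2 (not_lt.1 hlt))
  simp only [this, zero_div]

/-- The **Kakutani–Fan–Glicksberg fixed point theorem** in normed spaces. -/
theorem exists_mem_of_isClosed_graph {E : Type*} [NormedAddCommGroup E] [NormedSpace ℝ E]
    {K : Set E} (hne : K.Nonempty) (hcp : IsCompact K) (hcv : Convex ℝ K) {F : K → Set E}
    (hFK : ∀ x, F x ⊆ K) (hFne : ∀ x, (F x).Nonempty) (hFcv : ∀ x, Convex ℝ (F x))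
    (hF : IsClosed {p : K × E | p.2 ∈ F p.1}) : ∃ x : K, (x : E) ∈ F x := by
  have : CompactSpace K := isCompact_iff_compactSpace.1 hcp
  by_contra! hnot
  have husc : ∀ U : Set E, IsOpen U → IsOpen {x : K | F x ⊆ U} := by
    intro U hU
    have hcl : IsClosed {q : K × K | (q.2 : E) ∈ F q.1 ∧ (q.2 : E) ∉ U} :=
      (hF.preimage (f := fun q : K × K => (q.1, (q.2 : E))) (by fun_prop)).inter
        (hU.isClosed_compl.preimage (f := fun q : K × K => (q.2 : E)) (by fun_prop))
    rw [← isClosed_compl_iff]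
    convert isClosedMap_fst_of_compactSpace _ hcl using 1
    ext x
    constructor
    · intro h
      obtain ⟨y, hy, hyU⟩ := not_subset.1 h
      exact ⟨(x, ⟨y, hFK x hy⟩), ⟨hy, hyU⟩, rfl⟩
    · rintro ⟨⟨_, y⟩, ⟨hy, hyU⟩, rfl⟩ h
      exact hyU (h hy)
  have hsep : ∀ x : K, ∃ δ > 0, ∀ z ∈ F x, 2 * δ ≤ dist z x := by
    intro x
    have hcl : IsClosed (F x) := hF.preimage (f := fun z : E => (x, z)) (by fun_prop)
    obtain ⟨δ, hδ, hball⟩ := Metric.isOpen_iff.1 hcl.isOpen_compl x (hnot x)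
    refine ⟨δ / 2, half_pos hδ, fun z hz => ?_⟩
    rw [mul_div_cancel₀ _ two_ne_zero]
    by_contra! hlt
    exact hball hlt hz
  choose δ hδ hdist using hsep
  obtain ⟨ε, hε, hleb⟩ := lebesgue_number_lemma_of_metric (isCompact_univ (X := K))
    (c := fun x => {x' | F x' ⊆ thickening (δ x) (F x)} ∩ ball x (δ x))
    (fun x => (husc _ isOpen_thickening).inter isOpen_ball)
    (fun x _ => mem_iUnion.2 ⟨x, self_subset_thickening (hδ x) _, mem_ball_self (hδ x)⟩)
  obtain ⟨y, hy⟩ := exists_mem_convexHull_biUnion_ball hne hcp hcv hFK hFne hε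
  obtain ⟨x, hx⟩ := hleb y (mem_univ y)
  have hyU : (y : E) ∈ thickening (δ x) (F x) :=
    convexHull_min (iUnion₂_subset fun x' hx' => (hx hx').1) ((hFcv x).thickening _) hy
  obtain ⟨z, hz, hyz⟩ := mem_thickening_iff.1 hyU
  have hyx : dist (y : E) x < δ x := (hx (mem_ball_self hε)).2
  have := dist_triangle_left z (x : E) (y : E)
  linarith [hdist x z hz]

lemma UpperSemicontinuousSV.isClosed_graph {D Y : Type*} [TopologicalSpace D]
    [TopologicalSpace Y] [T4Space Y] {F : D → Set Y} (hF : UpperSemicontinuousSV F)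
    (hcl : ∀ x, IsClosed (F x)) : IsClosed {p : D × Y | p.2 ∈ F p.1} := by
  rw [← isOpen_compl_iff, isOpen_iff_mem_nhds]
  rintro ⟨x, y⟩ hxy
  obtain ⟨U, V, hU, hV, hFU, hyV, hUV⟩ := normal_separation (hcl x)
    (isClosed_singleton (x := y)) (disjoint_singleton_right.2 hxy)
  have hV' : ∀ᶠ y' in 𝓝 y, y' ∈ V := hV.mem_nhds (hyV rfl)
  filter_upwards [(hF x U hU hFU).prod_nhds hV'] with q hq hmem
  exact hUV.notMem_of_mem_left (hq.1 hmem) hq.2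

/-- existence of a Nash equilibrium for an abstract economy
`g = (C_ν, P_ν)_{ν ∈ N}` satisfying (A1)–(A4), where each action set `X ν` is a nonempty
compact convex subset of a real Banach space `E ν`. -/
theorem abstract_economy_existence
    {N : Type*} [Fintype N] [Nonempty N]
    {E : N → Type*} [∀ ν, NormedAddCommGroup (E ν)] [∀ ν, NormedSpace ℝ (E ν)]
    [∀ ν, CompleteSpace (E ν)]
    (X : ∀ ν, Set (E ν))
    (hXne : ∀ ν, (X ν).Nonempty) (hXcp : ∀ ν, IsCompact (X ν)) (hXcv : ∀ ν, Convex ℝ (X ν))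
    -- the abstract economy profile: constraint maps and preference maps into subsets of `X ν`,
    -- the constraint map `C ν` depending only on the coordinates other than `ν`
    (C P : ∀ ν : N, ((μ : N) → X μ) → Set (E ν))
    (hCsub : ∀ ν x, C ν x ⊆ X ν) (hPsub : ∀ ν x, P ν x ⊆ X ν)
    (hCdep : ∀ ν x y, (∀ μ, μ ≠ ν → x μ = y μ) → C ν x = C ν y)
    -- (A1)
    (hCusc : ∀ ν, UpperSemicontinuousSV (C ν)) (hPusc : ∀ ν, UpperSemicontinuousSV (P ν))
    (hCcl : ∀ ν x, IsClosed (C ν x)) (hCcv : ∀ ν x, Convex ℝ (C ν x))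
    (hPcl : ∀ ν x, IsClosed (P ν x)) (hPcv : ∀ ν x, Convex ℝ (P ν x))
    -- (A2)
    (hCne : ∀ ν x, (C ν x).Nonempty)
    -- (A3)
    (hIopen : ∀ ν, IsOpen {x : (μ : N) → X μ | (C ν x ∩ P ν x).Nonempty})
    -- (A4)
    (hA4 : ∀ ν (x : (μ : N) → X μ), (x ν : E ν) ∈ C ν x → (x ν : E ν) ∉ P ν x) :
    ∃ x : (μ : N) → X μ, ∀ ν, (x ν : E ν) ∈ C ν x ∧ C ν x ∩ P ν x = ∅ := by
  classical
  let F : ∀ ν : N, ((μ : N) → X μ) → Set (E ν) := fun ν x =>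
    {y | y ∈ C ν x ∧ ((C ν x ∩ P ν x).Nonempty → y ∈ P ν x)}
  have hFeq : ∀ ν x, F ν x = if (C ν x ∩ P ν x).Nonempty then C ν x ∩ P ν x else C ν x := by
    intro ν x
    ext y
    split_ifs with h <;> simp [F, h]
  have hFcl : ∀ ν, IsClosed {p : ((μ : N) → X μ) × E ν | p.2 ∈ F ν p.1} := by
    intro ν
    have hC := (hCusc ν).isClosed_graph (hCcl ν)
    have hP := (hPusc ν).isClosed_graph (hPcl ν)
    refine hC.inter (isClosed_imp ((hIopen ν).preimage continuous_fst) hP)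
  let K : Set (∀ ν, E ν) := univ.pi X
  let π : K → (μ : N) → X μ := fun x μ => ⟨x.1 μ, x.2 μ trivial⟩
  have hπ : Continuous π := continuous_pi fun μ => by
    exact ((continuous_apply μ).comp continuous_subtype_val).subtype_mk _
  obtain ⟨x, hx⟩ := exists_mem_of_isClosed_graph (K := K) (F := fun x => univ.pi fun ν => F ν (π x))
    (univ_pi_nonempty_iff.2 hXne) (isCompact_univ_pi hXcp) (convex_pi fun ν _ => hXcv ν)
    (fun x => pi_mono fun ν _ y hy => hCsub ν _ hy.1)
    (fun x => univ_pi_nonempty_iff.2 fun ν => by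
      rw [hFeq]
      split_ifs with h
      exacts [h, hCne ν _])
    (fun x => convex_pi fun ν _ => by
      rw [hFeq]
      split_ifs
      exacts [(hCcv ν _).inter (hPcv ν _), hCcv ν _])
    (by
      simp only [mem_univ_pi, ofPred_forall]
      exact isClosed_iInter fun ν => (hFcl ν).preimage
        (f := fun p : K × (∀ ν, E ν) => (π p.1, p.2 ν)) (by fun_prop))
  refine ⟨π x, fun ν => ?_⟩
  obtain ⟨hxC, hxP⟩ := hx ν trivial
  exact ⟨hxC, not_nonempty_iff_eq_empty.1 fun h => hA4 ν (π x) hxC (hxP h)⟩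
end

section
/- Let g = (C_ν, P_ν)_{ν∈N} be an abstract economy profile satisfying (A1) (each C_ν and P_ν upper semicontinuous with closed convex values), (A2) (each C_ν nonempty-valued), and (A3) (each set I_ν(g) := {x ∈ X : C_ν(x) ∩ P_ν(x) ≠ ∅} open in X). Then for each ν ∈ N the set-valued map x ↦ G_ν(g;x), defined by G_ν(g;x) = C_ν(x) ∩ P_ν(x) if C_ν(x) ∩ P_ν(x) ≠ ∅ and G_ν(g;x) = C_ν(x) otherwise, is upper semicontinuous on X with nonempty compact convex values. -/
open Metric Set Filter Topology

open Classical in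
/-- The map `G_ν(g;·)`: the intersection `C x ∩ P x` when it is nonempty, and `C x` otherwise. -/
noncomputable def Gmap {A B : Type*} (C P : A → Set B) (x : A) : Set B :=
  if (C x ∩ P x).Nonempty then C x ∩ P x else C x

/-- In a normal space the intersection of two upper semicontinuous closed-valued maps is upper
semicontinuous. -/
theorem UpperSemicontinuousSV.inter {D Y : Type*} [TopologicalSpace D] [TopologicalSpace Y]
    [NormalSpace Y] {F G : D → Set Y} (hF : UpperSemicontinuousSV F)
    (hG : UpperSemicontinuousSV G) (hFcl : ∀ x, IsClosed (F x)) (hGcl : ∀ x, IsClosed (G x)) :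
    UpperSemicontinuousSV (fun x => F x ∩ G x) := by
  intro x U hU hsub
  have hdisj : Disjoint (F x \ U) (G x) :=
    Set.disjoint_left.2 fun y hy hyG => hy.2 (hsub ⟨hy.1, hyG⟩)
  obtain ⟨V, W, hV, hW, hFV, hGW, hVW⟩ :=
    normal_separation ((hFcl x).sdiff hU) (hGcl x) hdisj
  filter_upwards [hF x (U ∪ V) (hU.union hV) (Set.sdiff_subset_iff.1 hFV), hG x W hW hGW]
    with z hzF hzG y hy
  exact (hzF hy.1).resolve_right fun hyV => Set.disjoint_left.1 hVW hyV (hzG hy.2)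

theorem Gmap_of_nonempty {A B : Type*} {C P : A → Set B} {x : A} (h : (C x ∩ P x).Nonempty) :
    Gmap C P x = C x ∩ P x :=
  if_pos h

theorem Gmap_of_not_nonempty {A B : Type*} {C P : A → Set B} {x : A}
    (h : ¬(C x ∩ P x).Nonempty) : Gmap C P x = C x :=
  if_neg h

theorem Gmap_subset {A B : Type*} (C P : A → Set B) (x : A) : Gmap C P x ⊆ C x := by
  by_cases h : (C x ∩ P x).Nonempty
  · rw [Gmap_of_nonempty h]
    exact Set.inter_subset_left
  · rw [Gmap_of_not_nonempty h]

theorem UpperSemicontinuousSV.gmap {D Y : Type*} [TopologicalSpace D] [TopologicalSpace Y]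
    [NormalSpace Y] {C P : D → Set Y} (hC : UpperSemicontinuousSV C)
    (hP : UpperSemicontinuousSV P) (hCcl : ∀ x, IsClosed (C x)) (hPcl : ∀ x, IsClosed (P x))
    (hI : IsOpen {x | (C x ∩ P x).Nonempty}) : UpperSemicontinuousSV (Gmap C P) := by
  intro x U hU hsub
  by_cases h : (C x ∩ P x).Nonempty
  · rw [Gmap_of_nonempty h] at hsub
    filter_upwards [hI.mem_nhds h, hC.inter hP hCcl hPcl x U hU hsub] with z hz hzU
    rwa [Gmap_of_nonempty hz]
  · rw [Gmap_of_not_nonempty h] at hsub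
    filter_upwards [hC x U hU hsub] with z hz
    exact (Gmap_subset C P z).trans hz

/-- under (A1)–(A3), each map `x ↦ G_ν(g;x)` is upper semicontinuous on `X`
with nonempty compact convex values. -/
theorem Gmap_usc_nonempty_compact_convex
    {N : Type*} [Fintype N] [Nonempty N]
    {E : N → Type*} [∀ ν, NormedAddCommGroup (E ν)] [∀ ν, NormedSpace ℝ (E ν)]
    [∀ ν, CompleteSpace (E ν)]
    (X : ∀ ν, Set (E ν))
    (hXne : ∀ ν, (X ν).Nonempty) (hXcp : ∀ ν, IsCompact (X ν)) (hXcv : ∀ ν, Convex ℝ (X ν))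
    (C P : ∀ ν : N, ((μ : N) → X μ) → Set (E ν))
    (hCsub : ∀ ν x, C ν x ⊆ X ν) (hPsub : ∀ ν x, P ν x ⊆ X ν)
    (hCdep : ∀ ν x y, (∀ μ, μ ≠ ν → x μ = y μ) → C ν x = C ν y)
    -- (A1)
    (hCusc : ∀ ν, UpperSemicontinuousSV (C ν)) (hPusc : ∀ ν, UpperSemicontinuousSV (P ν))
    (hCcl : ∀ ν x, IsClosed (C ν x)) (hCcv : ∀ ν x, Convex ℝ (C ν x))
    (hPcl : ∀ ν x, IsClosed (P ν x)) (hPcv : ∀ ν x, Convex ℝ (P ν x))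
    -- (A2)
    (hCne : ∀ ν x, (C ν x).Nonempty)
    -- (A3)
    (hIopen : ∀ ν, IsOpen {x : (μ : N) → X μ | (C ν x ∩ P ν x).Nonempty}) :
    ∀ ν, UpperSemicontinuousSV (Gmap (C ν) (P ν)) ∧
      ∀ x, (Gmap (C ν) (P ν) x).Nonempty ∧ IsCompact (Gmap (C ν) (P ν) x) ∧
        Convex ℝ (Gmap (C ν) (P ν) x) := by
  intro ν
  refine ⟨(hCusc ν).gmap (hPusc ν) (hCcl ν) (hPcl ν) (hIopen ν), fun x => ?_⟩
  have hCcp : IsCompact (C ν x) := (hXcp ν).of_isClosed_subset (hCcl ν x) (hCsub ν x)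
  by_cases h : (C ν x ∩ P ν x).Nonempty
  · rw [Gmap_of_nonempty h]
    exact ⟨h, hCcp.inter_right (hPcl ν x), (hCcv ν x).inter (hPcv ν x)⟩
  · rw [Gmap_of_not_nonempty h]
    exact ⟨hCne ν x, hCcp, hCcv ν x⟩
end

section
/- Let D be a metric space and Y a metric space. For each n ∈ ℕ let F_n be an upper semicontinuous set-valued map from D to the nonempty compact subsets of Y, let F̂ be a map from D to the nonempty compact subsets of Y, and suppose that sup_{x∈D} h(F_n(x), F̂(x)) → 0 as n → ∞ (uniform convergence in the Hausdorff distance). Then F̂ is upper semicontinuous on D. -/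
open Metric Set Filter Topology
open scoped ENNReal

/-- a uniform (in the Hausdorff distance) limit of upper semicontinuous
set-valued maps with nonempty compact values is upper semicontinuous. -/
theorem usc_of_uniform_hausdorff_limit {D Y : Type*} [MetricSpace D] [MetricSpace Y]
    (F : ℕ → D → Set Y) (Fhat : D → Set Y)
    (hFne : ∀ n x, (F n x).Nonempty) (hFcp : ∀ n x, IsCompact (F n x))
    (hFhatne : ∀ x, (Fhat x).Nonempty) (hFhatcp : ∀ x, IsCompact (Fhat x))
    (hFusc : ∀ n, UpperSemicontinuousSV (F n))
    (hconv : Tendsto (fun n => ⨆ x : D, EMetric.hausdorffEdist (F n x) (Fhat x))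
      atTop (𝓝 0)) :
    UpperSemicontinuousSV Fhat := by
  intro x U hU hxU
  obtain ⟨δ, hδ, hδU⟩ := (hFhatcp x).exists_thickening_subset_open hU hxU
  have hpos : 0 < ENNReal.ofReal (δ / 2) := ENNReal.ofReal_pos.2 (half_pos hδ)
  obtain ⟨n, hn⟩ := (hconv.eventually_lt_const hpos).exists
  have hdist : ∀ z, hausdorffEDist (F n z) (Fhat z) < ENNReal.ofReal (δ / 2) := fun z =>
    (le_iSup (fun z => hausdorffEDist (F n z) (Fhat z)) z).trans_lt hn
  have hsub : F n x ⊆ thickening (δ / 2) (Fhat x) := fun y hy =>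
    mem_thickening_iff_infEDist_lt.2 ((infEDist_le_hausdorffEDist_of_mem hy).trans_lt (hdist x))
  filter_upwards [hFusc n x _ isOpen_thickening hsub] with x' hx' y hy
  have hy' : y ∈ thickening (δ / 2) (F n x') :=
    mem_thickening_iff_infEDist_lt.2 ((infEDist_le_hausdorffEDist_of_mem hy).trans_lt
      (hausdorffEDist_comm.trans_lt (hdist x')))
  apply hδU
  rw [← add_halves δ]
  exact thickening_thickening_subset _ _ _ (thickening_subset_of_subset _ hx' hy')
end

section
/- Let (g^n), with g^n = (C_ν^n, P_ν^n)_{ν∈N}, be a sequence of abstract economy profiles such that for each n and ν: C_ν^n is upper semicontinuous with nonempty compact convex values and P_ν^n is upper semicontinuous with compact convex (possibly empty) values. Suppose (g^n) is Cauchy with respect to the distance ρ, i.e., ρ(g^n, g^m) → 0 as n, m → ∞. Then there exists a profile ĝ = (Ĉ_ν, P̂_ν)_{ν∈N} such that ρ(g^n, ĝ) → 0, and for each ν ∈ N the maps Ĉ_ν and P̂_ν are upper semicontinuous with compact convex values, Ĉ_ν having nonempty values, and Ĉ_ν(x) depending only on x_{-ν}. -/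
open Metric Set Filter Topology
open scoped ENNReal

/-- The distance `ρ` between two abstract economy profiles `(C, P)` and `(C', P')`:
`ρ = Σ_ν [ sup_x h(C_ν(x), C'_ν(x)) + sup_x h(P_ν(x), P'_ν(x)) ]`, with the Hausdorff
distance understood in the extended sense. -/
noncomputable def rho {N : Type*} [Fintype N]
    {E : N → Type*} [∀ ν, NormedAddCommGroup (E ν)]
    {X : ∀ ν, Set (E ν)}
    (C C' P P' : ∀ ν : N, ((μ : N) → X μ) → Set (E ν)) : ℝ≥0∞ :=
  ∑ ν, ((⨆ x, EMetric.hausdorffEdist (C ν x) (C' ν x)) +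
        (⨆ x, EMetric.hausdorffEdist (P ν x) (P' ν x)))

theorem subset_thickening_of_hausdorffEDist_lt {Y : Type*} [PseudoEMetricSpace Y] {s t : Set Y}
    {δ : ℝ} (h : hausdorffEDist s t < ENNReal.ofReal δ) : s ⊆ thickening δ t := fun _ hx =>
  mem_thickening_iff_infEDist_lt.2 ((infEDist_le_hausdorffEDist_of_mem hx).trans_lt h)

theorem IsClosed.subset_of_tendsto_hausdorffEDist {Y : Type*} [PseudoEMetricSpace Y]
    {A : ℕ → Set Y} {B X : Set Y} (hX : IsClosed X) (hA : ∀ n, A n ⊆ X)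
    (h : Tendsto (fun n => hausdorffEDist (A n) B) atTop (𝓝 0)) : B ⊆ X := by
  intro z hz
  rw [mem_iff_infEDist_zero_of_closed hX]
  refine le_antisymm (ge_of_tendsto' h fun n => ?_) zero_le
  rw [hausdorffEDist_comm]
  exact (infEDist_anti (hA n)).trans (infEDist_le_hausdorffEDist_of_mem hz)

theorem convex_of_tendsto_hausdorffEDist {E : Type*} [NormedAddCommGroup E] [NormedSpace ℝ E]
    {A : ℕ → Set E} {B : Set E} (hB : IsClosed B) (hA : ∀ n, Convex ℝ (A n))
    (h : Tendsto (fun n => hausdorffEDist (A n) B) atTop (𝓝 0)) : Convex ℝ B := by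
  intro a ha b hb s t hs ht hst
  rw [← hB.closure_eq, closure_eq_iInter_thickening B]
  refine mem_iInter₂.2 fun δ hδ => ?_
  obtain ⟨n, hn⟩ := (h.eventually_lt_const (ENNReal.ofReal_pos.2 (half_pos hδ))).exists
  have h₁ : B ⊆ thickening (δ / 2) (A n) :=
    subset_thickening_of_hausdorffEDist_lt (by rwa [hausdorffEDist_comm])
  have h₂ := thickening_subset_of_subset (δ / 2) (subset_thickening_of_hausdorffEDist_lt hn)
  have h₃ := thickening_thickening_subset (δ / 2) (δ / 2) B
  rw [add_halves] at h₃
  exact h₃ (h₂ ((hA n).thickening _ (h₁ ha) (h₁ hb) hs ht hst))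

theorem UpperSemicontinuousSV.of_tendstoUniformly {D Y : Type*} [TopologicalSpace D]
    [PseudoMetricSpace Y] {F : ℕ → D → Set Y} {G : D → Set Y}
    (hF : ∀ n, UpperSemicontinuousSV (F n)) (hG : ∀ x, IsCompact (G x))
    (h : Tendsto (fun n => ⨆ x, hausdorffEDist (F n x) (G x)) atTop (𝓝 0)) :
    UpperSemicontinuousSV G := by
  intro x U hU hGU
  obtain ⟨δ, hδ, hδU⟩ := (hG x).exists_thickening_subset_open hU hGU
  have hδ3 : 0 < δ / 3 := by positivity
  obtain ⟨n, hn⟩ := (h.eventually_lt_const (ENNReal.ofReal_pos.2 hδ3)).exists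
  have hn' y : hausdorffEDist (F n y) (G y) < ENNReal.ofReal (δ / 3) :=
    (le_iSup (fun y => hausdorffEDist (F n y) (G y)) y).trans_lt hn
  filter_upwards [hF n x _ isOpen_thickening (self_subset_thickening hδ3 _)] with y hy
  have h₁ : G y ⊆ thickening (δ / 3) (F n y) :=
    subset_thickening_of_hausdorffEDist_lt (by rw [hausdorffEDist_comm]; exact hn' y)
  have h₂ : F n y ⊆ thickening (δ / 3 + δ / 3) (G x) :=
    (hy.trans (thickening_subset_of_subset _ (subset_thickening_of_hausdorffEDist_lt (hn' x)))).trans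
      (thickening_thickening_subset _ _ _)
  have h₃ := (h₁.trans (thickening_subset_of_subset _ h₂)).trans
    (thickening_thickening_subset _ _ _)
  rw [← add_assoc, add_thirds] at h₃
  exact h₃.trans hδU

/-- A uniformly Cauchy sequence of closed-valued maps into a complete space converges uniformly,
in the Hausdorff distance, to a closed-valued map. -/
theorem exists_tendsto_iSup_hausdorffEDist {D Y : Type*} [EMetricSpace Y] [CompleteSpace Y]
    {F : ℕ → D → Set Y} (hF : ∀ n x, IsClosed (F n x))
    (h : ∀ ε : ℝ≥0∞, 0 < ε → ∃ K, ∀ m ≥ K, ∀ n ≥ K, ∀ x, hausdorffEDist (F m x) (F n x) < ε) :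
    ∃ G : D → Set Y, (∀ x, IsClosed (G x)) ∧
      Tendsto (fun n => ⨆ x, hausdorffEDist (F n x) (G x)) atTop (𝓝 0) := by
  let c (n : ℕ) (x : D) : TopologicalSpace.Closeds Y := ⟨F n x, hF n x⟩
  have hc x : ∃ L, Tendsto (fun n => c n x) atTop (𝓝 L) := by
    refine cauchySeq_tendsto_of_complete (EMetric.cauchySeq_iff.2 fun ε hε => ?_)
    obtain ⟨K, hK⟩ := h ε hε
    exact ⟨K, fun m hm n hn => hK m hm n hn x⟩
  choose L hL using hc
  refine ⟨fun x => L x, fun x => (L x).isClosed, ENNReal.tendsto_nhds_zero.2 fun ε hε => ?_⟩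
  obtain ⟨K, hK⟩ := h ε hε
  filter_upwards [eventually_ge_atTop K] with m hm
  refine iSup_le fun x => le_of_tendsto (tendsto_const_nhds.edist (hL x) :
    Tendsto (fun n => edist (c m x) (c n x)) atTop (𝓝 (edist (c m x) (L x)))) ?_
  filter_upwards [eventually_ge_atTop K] with n hn using (hK m hm n hn x).le

/-- a `ρ`-Cauchy sequence of abstract economy profiles, each having upper
semicontinuous constraint maps with nonempty compact convex values and upper semicontinuous
preference maps with compact convex values, converges in `ρ` to a profile `ĝ = (Ĉ, P̂)` with
the same properties (`Ĉ_ν` being nonempty-valued and depending only on `x_{-ν}`). -/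
theorem profiles_cauchy_limit
    {N : Type*} [Fintype N] [Nonempty N]
    {E : N → Type*} [∀ ν, NormedAddCommGroup (E ν)] [∀ ν, NormedSpace ℝ (E ν)]
    [∀ ν, CompleteSpace (E ν)]
    (X : ∀ ν, Set (E ν))
    (hXne : ∀ ν, (X ν).Nonempty) (hXcp : ∀ ν, IsCompact (X ν)) (hXcv : ∀ ν, Convex ℝ (X ν))
    (C P : ℕ → ∀ ν : N, ((μ : N) → X μ) → Set (E ν))
    (hCsub : ∀ n ν x, C n ν x ⊆ X ν) (hPsub : ∀ n ν x, P n ν x ⊆ X ν)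
    (hCdep : ∀ n ν x y, (∀ μ, μ ≠ ν → x μ = y μ) → C n ν x = C n ν y)
    (hCusc : ∀ n ν, UpperSemicontinuousSV (C n ν))
    (hPusc : ∀ n ν, UpperSemicontinuousSV (P n ν))
    (hCne : ∀ n ν x, (C n ν x).Nonempty)
    (hCcp : ∀ n ν x, IsCompact (C n ν x)) (hCcv : ∀ n ν x, Convex ℝ (C n ν x))
    (hPcp : ∀ n ν x, IsCompact (P n ν x)) (hPcv : ∀ n ν x, Convex ℝ (P n ν x))
    (hCauchy : ∀ ε : ℝ≥0∞, 0 < ε → ∃ K, ∀ m ≥ K, ∀ n ≥ K,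
      rho (C m) (C n) (P m) (P n) < ε) :
    ∃ Chat Phat : ∀ ν : N, ((μ : N) → X μ) → Set (E ν),
      Tendsto (fun n => rho (C n) Chat (P n) Phat) atTop (𝓝 0) ∧
      (∀ ν x, Chat ν x ⊆ X ν) ∧ (∀ ν x, Phat ν x ⊆ X ν) ∧
      (∀ ν x y, (∀ μ, μ ≠ ν → x μ = y μ) → Chat ν x = Chat ν y) ∧
      (∀ ν, UpperSemicontinuousSV (Chat ν)) ∧ (∀ ν, UpperSemicontinuousSV (Phat ν)) ∧
      (∀ ν x, (Chat ν x).Nonempty) ∧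
      (∀ ν x, IsCompact (Chat ν x)) ∧ (∀ ν x, Convex ℝ (Chat ν x)) ∧
      (∀ ν x, IsCompact (Phat ν x)) ∧ (∀ ν x, Convex ℝ (Phat ν x)) := by
  have hle : ∀ m n ν x, hausdorffEDist (C m ν x) (C n ν x) ≤ rho (C m) (C n) (P m) (P n) ∧
      hausdorffEDist (P m ν x) (P n ν x) ≤ rho (C m) (C n) (P m) (P n) := by
    intro m n ν x
    have hν := Finset.single_le_sum (f := fun ν =>
      (⨆ x, hausdorffEDist (C m ν x) (C n ν x)) + ⨆ x, hausdorffEDist (P m ν x) (P n ν x))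
      (fun _ _ => zero_le) (Finset.mem_univ ν)
    exact ⟨((le_iSup (fun x => hausdorffEDist (C m ν x) (C n ν x)) x).trans le_self_add).trans hν,
      ((le_iSup (fun x => hausdorffEDist (P m ν x) (P n ν x)) x).trans le_add_self).trans hν⟩
  have hC ν := exists_tendsto_iSup_hausdorffEDist (F := fun n => C n ν)
    (fun n x => (hCcp n ν x).isClosed) fun ε hε =>
      (hCauchy ε hε).imp fun K hK m hm n hn x => (hle m n ν x).1.trans_lt (hK m hm n hn)
  have hP ν := exists_tendsto_iSup_hausdorffEDist (F := fun n => P n ν)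
    (fun n x => (hPcp n ν x).isClosed) fun ε hε =>
      (hCauchy ε hε).imp fun K hK m hm n hn x => (hle m n ν x).2.trans_lt (hK m hm n hn)
  choose G hGcl hG using hC
  choose Q hQcl hQ using hP
  have hGx ν x : Tendsto (fun n => hausdorffEDist (C n ν x) (G ν x)) atTop (𝓝 0) :=
    tendsto_of_tendsto_of_tendsto_of_le_of_le tendsto_const_nhds (hG ν) (fun _ => zero_le)
      fun n => le_iSup (fun x => hausdorffEDist (C n ν x) (G ν x)) x
  have hQx ν x : Tendsto (fun n => hausdorffEDist (P n ν x) (Q ν x)) atTop (𝓝 0) :=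
    tendsto_of_tendsto_of_tendsto_of_le_of_le tendsto_const_nhds (hQ ν) (fun _ => zero_le)
      fun n => le_iSup (fun x => hausdorffEDist (P n ν x) (Q ν x)) x
  have hGX ν x : G ν x ⊆ X ν :=
    (hXcp ν).isClosed.subset_of_tendsto_hausdorffEDist (fun n => hCsub n ν x) (hGx ν x)
  have hQX ν x : Q ν x ⊆ X ν :=
    (hXcp ν).isClosed.subset_of_tendsto_hausdorffEDist (fun n => hPsub n ν x) (hQx ν x)
  have hGcp ν x : IsCompact (G ν x) := (hXcp ν).of_isClosed_subset (hGcl ν x) (hGX ν x)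
  have hQcp ν x : IsCompact (Q ν x) := (hXcp ν).of_isClosed_subset (hQcl ν x) (hQX ν x)
  refine ⟨G, Q, ?_, hGX, hQX, fun ν x y hxy => ?_,
    fun ν => .of_tendstoUniformly (fun n => hCusc n ν) (hGcp ν) (hG ν),
    fun ν => .of_tendstoUniformly (fun n => hPusc n ν) (hQcp ν) (hQ ν), fun ν x => ?_, hGcp,
    fun ν x => convex_of_tendsto_hausdorffEDist (hGcl ν x) (fun n => hCcv n ν x) (hGx ν x), hQcp,
    fun ν x => convex_of_tendsto_hausdorffEDist (hQcl ν x) (fun n => hPcv n ν x) (hQx ν x)⟩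
  · have hsum := tendsto_finsetSum Finset.univ fun ν _ => (hG ν).add (hQ ν)
    rw [add_zero, Finset.sum_const_zero] at hsum
    exact hsum
  · rw [← (hGcl ν x).hausdorffEDist_zero_iff (hGcl ν y)]
    have hsum := (hGx ν x).add (hGx ν y)
    rw [add_zero] at hsum
    refine le_antisymm (ge_of_tendsto' hsum fun n => ?_) zero_le
    rw [hausdorffEDist_comm (s := C n ν x), ← hCdep n ν x y hxy]
    exact hausdorffEDist_triangle
  · obtain ⟨n, hn⟩ := ((hGx ν x).eventually_lt_const ENNReal.zero_lt_top).exists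
    exact nonempty_of_hausdorffEDist_ne_top (hCne n ν x) hn.ne
end

section
/- Let g = (C_ν, P_ν)_{ν∈N} be an abstract economy profile such that each C_ν has nonempty compact values, each P_ν has compact values, and (A4) holds: for each ν and x ∈ X, x_ν ∈ C_ν(x) implies x_ν ∉ P_ν(x). Then the gap function γ(g;·) satisfies: γ(g;x) ≥ 0 for all x ∈ X, and γ(g;x) = 0 if and only if x is a Nash equilibrium of g. -/
open Metric Set Filter Topology

/-- The gap function `γ(g;x) = max_ν d(x_ν, G_ν(g;x))` of the abstract economy `g = (C, P)`. -/
noncomputable def gapFun {N : Type*} [Fintype N]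
    {E : N → Type*} [∀ ν, NormedAddCommGroup (E ν)]
    {X : ∀ ν, Set (E ν)}
    (C P : ∀ ν : N, ((μ : N) → X μ) → Set (E ν)) (x : (μ : N) → X μ) : ℝ :=
  ⨆ ν, Metric.infDist (x ν : E ν) (Gmap (C ν) (P ν) x)

/-- The values of `G_ν` are nonempty when those of `C` are. -/
theorem Gmap_nonempty {A B : Type*} {C P : A → Set B} {x : A} (hC : (C x).Nonempty) :
    (Gmap C P x).Nonempty := by
  unfold Gmap
  split_ifs with h
  exacts [h, hC]

/-- The values of `G_ν` are compact when those of `C` and `P` are. -/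
theorem isCompact_Gmap {A B : Type*} [TopologicalSpace B] [T2Space B] {C P : A → Set B} {x : A}
    (hC : IsCompact (C x)) (hP : IsCompact (P x)) : IsCompact (Gmap C P x) := by
  unfold Gmap
  split_ifs
  exacts [hC.inter hP, hC]

/-- Under (A4), a point of `G_ν` is feasible and has no feasible preferred alternative. -/
theorem mem_Gmap_iff {A B : Type*} {C P : A → Set B} {x : A} {b : B} (h : b ∈ C x → b ∉ P x) :
    b ∈ Gmap C P x ↔ b ∈ C x ∧ C x ∩ P x = ∅ := by
  unfold Gmap
  split_ifs with hne
  · exact ⟨fun hb => absurd hb.2 (h hb.1), fun hb => absurd hb.2 hne.ne_empty⟩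
  · exact (and_iff_left (not_nonempty_iff_eq_empty.1 hne)).symm

/-- A finite supremum of nonnegative reals vanishes iff every term does. -/
theorem ciSup_eq_zero_iff_of_nonneg {ι : Type*} [Finite ι] {f : ι → ℝ} (hf : ∀ i, 0 ≤ f i) :
    ⨆ i, f i = 0 ↔ ∀ i, f i = 0 := by
  refine ⟨fun h i => le_antisymm ?_ (hf i), fun h => by simp [h]⟩
  exact h ▸ le_ciSup (Set.finite_range f).bddAbove i

/-- if each `C_ν` has nonempty compact values, each `P_ν` has compact values,
and (A4) holds, then the gap function `γ(g;·)` is nonnegative and vanishes exactly at the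
Nash equilibria of `g`. -/
theorem gapFun_nonneg_and_eq_zero_iff_nash
    {N : Type*} [Fintype N] [Nonempty N]
    {E : N → Type*} [∀ ν, NormedAddCommGroup (E ν)] [∀ ν, NormedSpace ℝ (E ν)]
    [∀ ν, CompleteSpace (E ν)]
    (X : ∀ ν, Set (E ν))
    (hXne : ∀ ν, (X ν).Nonempty) (hXcp : ∀ ν, IsCompact (X ν)) (hXcv : ∀ ν, Convex ℝ (X ν))
    (C P : ∀ ν : N, ((μ : N) → X μ) → Set (E ν))
    (hCsub : ∀ ν x, C ν x ⊆ X ν) (hPsub : ∀ ν x, P ν x ⊆ X ν)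
    (hCdep : ∀ ν x y, (∀ μ, μ ≠ ν → x μ = y μ) → C ν x = C ν y)
    (hCne : ∀ ν x, (C ν x).Nonempty) (hCcp : ∀ ν x, IsCompact (C ν x))
    (hPcp : ∀ ν x, IsCompact (P ν x))
    -- (A4)
    (hA4 : ∀ ν (x : (μ : N) → X μ), (x ν : E ν) ∈ C ν x → (x ν : E ν) ∉ P ν x) :
    ∀ x : (μ : N) → X μ,
      0 ≤ gapFun C P x ∧
      (gapFun C P x = 0 ↔ ∀ ν, (x ν : E ν) ∈ C ν x ∧ C ν x ∩ P ν x = ∅) := by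
  intro x
  have hnonneg : ∀ ν, 0 ≤ Metric.infDist (x ν : E ν) (Gmap (C ν) (P ν) x) :=
    fun ν => Metric.infDist_nonneg
  refine ⟨Real.iSup_nonneg hnonneg, (ciSup_eq_zero_iff_of_nonneg hnonneg).trans ?_⟩
  refine forall_congr' fun ν => ?_
  rw [← (isCompact_Gmap (hCcp ν x) (hPcp ν x)).isClosed.mem_iff_infDist_zero
    (Gmap_nonempty (hCne ν x)), mem_Gmap_iff (hA4 ν x)]
end

section
/- Let A, A', B, B' be nonempty compact subsets of a metric space with A ∩ B ≠ ∅ and A' ∩ B' ≠ ∅. Let α > 0 and suppose that for every ε > 0 one has N_ε[A] ∩ N_ε[B] ⊆ N_{αε}[A ∩ B] and N_ε[A'] ∩ N_ε[B'] ⊆ N_{αε}[A' ∩ B']. Then h(A ∩ B, A' ∩ B') ≤ α · max{h(A, A'), h(B, B')}. -/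
open Metric Set Filter Topology
open scoped ENNReal

/-- under the metric regularity condition
`N_ε[A] ∩ N_ε[B] ⊆ N_{cε}[A ∩ B]` (and the analogue for `A'`, `B'`), the Hausdorff distance of
the intersections is controlled: `h(A ∩ B, A' ∩ B') ≤ c · max{h(A,A'), h(B,B')}`. -/
theorem hausdorffDist_inter_le {X : Type*} [MetricSpace X]
    (A A' B B' : Set X)
    (hAne : A.Nonempty) (hAcp : IsCompact A) (hA'ne : A'.Nonempty) (hA'cp : IsCompact A')
    (hBne : B.Nonempty) (hBcp : IsCompact B) (hB'ne : B'.Nonempty) (hB'cp : IsCompact B')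
    (hAB : (A ∩ B).Nonempty) (hA'B' : (A' ∩ B').Nonempty)
    (c : ℝ) (hc : 0 < c)
    (hreg : ∀ ε : ℝ, 0 < ε →
      Metric.thickening ε A ∩ Metric.thickening ε B ⊆ Metric.thickening (c * ε) (A ∩ B))
    (hreg' : ∀ ε : ℝ, 0 < ε →
      Metric.thickening ε A' ∩ Metric.thickening ε B' ⊆ Metric.thickening (c * ε) (A' ∩ B')) :
    Metric.hausdorffDist (A ∩ B) (A' ∩ B') ≤
      c * max (Metric.hausdorffDist A A') (Metric.hausdorffDist B B') := by
  have hA := hausdorffEDist_ne_top_of_nonempty_of_bounded hAne hA'ne hAcp.isBounded hA'cp.isBounded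
  have hB := hausdorffEDist_ne_top_of_nonempty_of_bounded hBne hB'ne hBcp.isBounded hB'cp.isBounded
  rw [← div_le_iff₀' hc]
  refine le_of_forall_gt_imp_ge_of_dense fun r hr => ?_
  obtain ⟨hrA, hrB⟩ := max_lt_iff.mp hr
  have hr0 : 0 < r := hausdorffDist_nonneg.trans_lt hrA
  rw [div_le_iff₀' hc]
  refine hausdorffDist_le_of_mem_dist (mul_pos hc hr0).le ?_ ?_
  · rintro x ⟨hxA, hxB⟩
    obtain ⟨y, hy, hxy⟩ := mem_thickening_iff.mp (hreg' r hr0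
      ⟨mem_thickening_iff.mpr (exists_dist_lt_of_hausdorffDist_lt hxA hrA hA),
        mem_thickening_iff.mpr (exists_dist_lt_of_hausdorffDist_lt hxB hrB hB)⟩)
    exact ⟨y, hy, hxy.le⟩
  · rintro x ⟨hxA, hxB⟩
    rw [hausdorffDist_comm] at hrA hrB
    rw [hausdorffEDist_comm] at hA hB
    obtain ⟨y, hy, hxy⟩ := mem_thickening_iff.mp (hreg r hr0
      ⟨mem_thickening_iff.mpr (exists_dist_lt_of_hausdorffDist_lt hxA hrA hA),
        mem_thickening_iff.mpr (exists_dist_lt_of_hausdorffDist_lt hxB hrB hB)⟩)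
    exact ⟨y, hy, hxy.le⟩
end

section
/- Fix open sets I_ν ⊆ X (ν ∈ N) and constants τ > 0, α > 0. Let (g^n) and ĝ be abstract economy profiles, each satisfying: (A1) upper semicontinuous constraint and preference maps with compact convex values; (A2) nonempty-valued constraint maps; (A3) with common improvement sets {x ∈ X : C_ν(x) ∩ P_ν(x) ≠ ∅} = I_ν for every ν; (Ψ1) with the common constant τ: x_ν ∈ C_ν(x) implies d(x_ν, p) ≥ τ for every p ∈ P_ν(x); and (Ψ2) with the common constant α: for every ε > 0, ν, and x with C_ν(x) ∩ P_ν(x) ≠ ∅, N_ε[C_ν(x)] ∩ N_ε[P_ν(x)] ⊆ N_{αε}[C_ν(x) ∩ P_ν(x)]. If ρ(g^n, ĝ) → 0, x^n ∈ NE(g^n) for every n, and x^n → x̂ in X, then x̂ ∈ NE(ĝ). In particular, since X is compact, the solution map g ↦ NE(g) is upper semicontinuous on any such class endowed with the distance ρ. -/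
open Metric Set Filter Topology
open scoped ENNReal

/-- The distance `ρ` controls the Hausdorff distance between constraint sets. -/
theorem hausdorffEDist_constraint_le_rho {N : Type*} [Fintype N]
    {E : N → Type*} [∀ ν, NormedAddCommGroup (E ν)] {X : ∀ ν, Set (E ν)}
    (C C' P P' : ∀ ν : N, ((μ : N) → X μ) → Set (E ν)) (ν : N) (x : (μ : N) → X μ) :
    Metric.hausdorffEDist (C ν x) (C' ν x) ≤ rho C C' P P' :=
  calc
    Metric.hausdorffEDist (C ν x) (C' ν x)
        ≤ ⨆ x, Metric.hausdorffEDist (C ν x) (C' ν x) :=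
      le_iSup (fun x => Metric.hausdorffEDist (C ν x) (C' ν x)) x
    _ ≤ (⨆ x, Metric.hausdorffEDist (C ν x) (C' ν x)) +
        ⨆ x, Metric.hausdorffEDist (P ν x) (P' ν x) := le_self_add
    _ ≤ rho C C' P P' :=
      Finset.single_le_sum (f := fun ν => (⨆ x, Metric.hausdorffEDist (C ν x) (C' ν x)) +
        ⨆ x, Metric.hausdorffEDist (P ν x) (P' ν x)) (fun _ _ => zero_le) (Finset.mem_univ ν)

/-- Points asymptotically close to the values of an upper semicontinuous map along a convergent
sequence of arguments accumulate only in the value at the limit, when that value is closed. -/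
theorem UpperSemicontinuousSV.mem_of_tendsto {D Y ι : Type*} [TopologicalSpace D]
    [PseudoEMetricSpace Y] {F : D → Set Y} (hF : UpperSemicontinuousSV F) {l : Filter ι} [l.NeBot]
    {u : ι → D} {y : ι → Y} {d : D} {z : Y} (hclosed : IsClosed (F d))
    (hu : Tendsto u l (𝓝 d)) (hy : Tendsto y l (𝓝 z))
    (h : Tendsto (fun i => Metric.infEDist (y i) (F (u i))) l (𝓝 0)) : z ∈ F d := by
  rw [Metric.mem_iff_infEDist_zero_of_closed hclosed]
  have hlim : Tendsto (fun i => Metric.infEDist (y i) (F d)) l (𝓝 (Metric.infEDist z (F d))) :=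
    Metric.continuous_infEDist.continuousAt.tendsto.comp hy
  refine le_antisymm (le_of_forall_pos_le_add fun ε hε => ?_) zero_le
  have hε2 : 0 < ε / 2 := ENNReal.half_pos hε.ne'
  have hopen : IsOpen {w | Metric.infEDist w (F d) < ε / 2} :=
    isOpen_lt Metric.continuous_infEDist continuous_const
  have hsub : F d ⊆ {w | Metric.infEDist w (F d) < ε / 2} := fun w hw => by
    simpa [Metric.infEDist_zero_of_mem hw] using hε.ne'
  refine le_of_tendsto hlim ?_
  filter_upwards [hu.eventually (hF d _ hopen hsub), h.eventually (gt_mem_nhds hε2)] with i hi hd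
  obtain ⟨w, hw, hdist⟩ := Metric.infEDist_lt_iff.1 hd
  calc
    Metric.infEDist (y i) (F d) ≤ edist (y i) w + Metric.infEDist w (F d) :=
      Metric.infEDist_le_edist_add_infEDist
    _ ≤ ε / 2 + ε / 2 := add_le_add hdist.le (hi hw).le
    _ = 0 + ε := by rw [ENNReal.add_halves, zero_add]

/-- upper semicontinuity (closedness) of the solution map `g ↦ NE(g)` on a class
of abstract economy profiles sharing the improvement sets `I_ν` (condition (A3)) and the
constants `τ` (condition (Ψ1)) and `α` (condition (Ψ2)): if `ρ(gⁿ, ĝ) → 0`,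
`xⁿ ∈ NE(gⁿ)` for every `n`, and `xⁿ → x̂`, then `x̂ ∈ NE(ĝ)`. -/
theorem nash_set_closed_graph
    {N : Type*} [Fintype N] [Nonempty N]
    {E : N → Type*} [∀ ν, NormedAddCommGroup (E ν)] [∀ ν, NormedSpace ℝ (E ν)]
    [∀ ν, CompleteSpace (E ν)]
    (X : ∀ ν, Set (E ν))
    (hXne : ∀ ν, (X ν).Nonempty) (hXcp : ∀ ν, IsCompact (X ν)) (hXcv : ∀ ν, Convex ℝ (X ν))
    -- fixed open improvement sets and regularity constants
    (I : ∀ _ : N, Set ((μ : N) → X μ)) (hIopen : ∀ ν, IsOpen (I ν))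
    (τ : ℝ) (hτ : 0 < τ) (a : ℝ) (ha : 0 < a)
    -- the sequence of profiles and its limit
    (C P : ℕ → ∀ ν : N, ((μ : N) → X μ) → Set (E ν))
    (Chat Phat : ∀ ν : N, ((μ : N) → X μ) → Set (E ν))
    -- each gⁿ satisfies (A1), (A2), (A3), (Ψ1), (Ψ2)
    (hCsub : ∀ n ν x, C n ν x ⊆ X ν) (hPsub : ∀ n ν x, P n ν x ⊆ X ν)
    (hCdep : ∀ n ν x y, (∀ μ, μ ≠ ν → x μ = y μ) → C n ν x = C n ν y)
    (hCusc : ∀ n ν, UpperSemicontinuousSV (C n ν))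
    (hPusc : ∀ n ν, UpperSemicontinuousSV (P n ν))
    (hCcp : ∀ n ν x, IsCompact (C n ν x)) (hCcv : ∀ n ν x, Convex ℝ (C n ν x))
    (hPcp : ∀ n ν x, IsCompact (P n ν x)) (hPcv : ∀ n ν x, Convex ℝ (P n ν x))
    (hCne : ∀ n ν x, (C n ν x).Nonempty)
    (hI : ∀ n ν, {x : (μ : N) → X μ | (C n ν x ∩ P n ν x).Nonempty} = I ν)
    (hΨ1 : ∀ n ν (x : (μ : N) → X μ), (x ν : E ν) ∈ C n ν x →
      ∀ p ∈ P n ν x, τ ≤ dist (x ν : E ν) p)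
    (hΨ2 : ∀ n ν x, (C n ν x ∩ P n ν x).Nonempty → ∀ ε : ℝ, 0 < ε →
      Metric.thickening ε (C n ν x) ∩ Metric.thickening ε (P n ν x) ⊆
        Metric.thickening (a * ε) (C n ν x ∩ P n ν x))
    -- ĝ satisfies (A1), (A2), (A3), (Ψ1), (Ψ2)
    (hChatsub : ∀ ν x, Chat ν x ⊆ X ν) (hPhatsub : ∀ ν x, Phat ν x ⊆ X ν)
    (hChatdep : ∀ ν x y, (∀ μ, μ ≠ ν → x μ = y μ) → Chat ν x = Chat ν y)
    (hChatusc : ∀ ν, UpperSemicontinuousSV (Chat ν))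
    (hPhatusc : ∀ ν, UpperSemicontinuousSV (Phat ν))
    (hChatcp : ∀ ν x, IsCompact (Chat ν x)) (hChatcv : ∀ ν x, Convex ℝ (Chat ν x))
    (hPhatcp : ∀ ν x, IsCompact (Phat ν x)) (hPhatcv : ∀ ν x, Convex ℝ (Phat ν x))
    (hChatne : ∀ ν x, (Chat ν x).Nonempty)
    (hIhat : ∀ ν, {x : (μ : N) → X μ | (Chat ν x ∩ Phat ν x).Nonempty} = I ν)
    (hΨ1hat : ∀ ν (x : (μ : N) → X μ), (x ν : E ν) ∈ Chat ν x →
      ∀ p ∈ Phat ν x, τ ≤ dist (x ν : E ν) p)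
    (hΨ2hat : ∀ ν x, (Chat ν x ∩ Phat ν x).Nonempty → ∀ ε : ℝ, 0 < ε →
      Metric.thickening ε (Chat ν x) ∩ Metric.thickening ε (Phat ν x) ⊆
        Metric.thickening (a * ε) (Chat ν x ∩ Phat ν x))
    -- convergence of the profiles, equilibria along the sequence, convergence of points
    (hρ : Tendsto (fun n => rho (C n) Chat (P n) Phat) atTop (𝓝 0))
    (x : ℕ → ((μ : N) → X μ)) (xhat : (μ : N) → X μ)
    (hNE : ∀ n ν, (x n ν : E ν) ∈ C n ν (x n) ∧ C n ν (x n) ∩ P n ν (x n) = ∅)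
    (hx : Tendsto x atTop (𝓝 xhat)) :
    ∀ ν, (xhat ν : E ν) ∈ Chat ν xhat ∧ Chat ν xhat ∩ Phat ν xhat = ∅ := by
  intro ν
  constructor
  · have hmem : ∀ n, Metric.infEDist (x n ν : E ν) (Chat ν (x n)) ≤
        rho (C n) Chat (P n) Phat := fun n =>
      (Metric.infEDist_le_hausdorffEDist_of_mem (hNE n ν).1).trans
        (hausdorffEDist_constraint_le_rho (C n) Chat (P n) Phat ν (x n))
    have hxν : Tendsto (fun n => (x n ν : E ν)) atTop (𝓝 (xhat ν : E ν)) :=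
      (continuous_subtype_val.tendsto _).comp (tendsto_pi_nhds.1 hx ν)
    exact (hChatusc ν).mem_of_tendsto (hChatcp ν xhat).isClosed hx hxν
      (tendsto_of_tendsto_of_tendsto_of_le_of_le tendsto_const_nhds hρ (fun _ => zero_le) hmem)
  · by_contra hne
    have hxhat : xhat ∈ I ν := by
      rw [← hIhat ν]
      exact nonempty_iff_ne_empty.2 hne
    obtain ⟨n, hn⟩ := (hx.eventually ((hIopen ν).mem_nhds hxhat)).exists
    rw [← hI n ν] at hn
    exact hn.ne_empty (hNE n ν).2
end
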